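/- Let X be a Poisson random variable with mean m > 0. Then E|X − m|^5 = (10·m^2 + m)·(1 − 2·F(m)) + 2·((⌊m⌋ + 1 − m)^4 + 2·m·(2·(m − ⌊m⌋)^2 + 7·⌊m⌋ + 7 − 3·m))·e^{-m}·m^{⌊m⌋+1}/⌊m⌋!, where F(m) = P(X ≤ m) and ⌊·⌋ denotes the floor function. -/

import Mathlib

/-- The Poisson probability mass at `j` for a Poisson distribution with mean `m`:
`P(X = j) = e^{-m} m^j / j!`. -/
noncomputable def poissonWeight (m : ℝ) (j : ℕ) : ℝ :=
  Real.exp (-m) * m ^ j / (Nat.factorial j : ℝ)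

/-- `poissonCDF m b = P(X ≤ b)`, the cumulative distribution function of a
Poisson random variable `X` with mean `m`. -/
noncomputable def poissonCDF (m b : ℝ) : ℝ :=
  ∑' j : ℕ, if (j : ℝ) ≤ b then poissonWeight m j else 0

open Filter Topology Finset

/-- The polynomial solving the Stein equation
`m * q (x + 1) - x * q x = (x - m) ^ 5 - (10 * m ^ 2 + m)` is `q = -fifthSteinPoly m`. -/
def fifthSteinPoly (m x : ℝ) : ℝ :=
  (x - m) ^ 4 + 2 * m * (2 * (x - 1 - m) ^ 2 + 7 * x - 3 * m)

theorem poissonWeight_nonneg {m : ℝ} (hm : 0 ≤ m) (j : ℕ) : 0 ≤ poissonWeight m j := by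
  unfold poissonWeight
  positivity

theorem succ_mul_poissonWeight_succ (m : ℝ) (j : ℕ) :
    ((j : ℝ) + 1) * poissonWeight m (j + 1) = m * poissonWeight m j := by
  unfold poissonWeight
  rw [Nat.factorial_succ]
  push_cast
  field_simp
  ring

theorem hasSum_poissonWeight (m : ℝ) : HasSum (poissonWeight m) 1 := by
  have h := (NormedSpace.expSeries_div_hasSum_exp m).mul_left (Real.exp (-m))
  rw [← Real.exp_eq_exp_ℝ, ← Real.exp_add, neg_add_cancel, Real.exp_zero] at h
  have hw : poissonWeight m = fun j => Real.exp (-m) * (m ^ j / (j.factorial : ℝ)) :=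
    funext fun j => mul_div_assoc _ _ _
  rwa [hw]

theorem tendsto_pow_mul_poissonWeight (m : ℝ) (k : ℕ) :
    Tendsto (fun N : ℕ => (N : ℝ) ^ k * poissonWeight m N) atTop (𝓝 0) := by
  have h1 := tendsto_pow_const_div_const_pow_of_one_lt k (one_lt_two : (1 : ℝ) < 2)
  have h2 := FloorSemiring.tendsto_pow_div_factorial_atTop (2 * m)
  have h := (h1.mul h2).const_mul (Real.exp (-m))
  rw [mul_zero, mul_zero] at h
  refine h.congr fun N => ?_
  unfold poissonWeight
  rw [mul_pow]
  field_simp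

theorem tendsto_mul_fifthSteinPoly_mul_poissonWeight (m : ℝ) :
    Tendsto (fun N : ℕ => (N : ℝ) * fifthSteinPoly m N * poissonWeight m N) atTop (𝓝 0) := by
  have h := tendsto_pow_mul_poissonWeight m
  have hsum := (((((h 5).add ((h 4).const_mul (-4 * m))).add
    ((h 3).const_mul (6 * m ^ 2 + 4 * m))).add
    ((h 2).const_mul (-4 * m ^ 3 - 8 * m ^ 2 + 6 * m))).add
    ((h 1).const_mul (m ^ 4 + 4 * m ^ 3 + 2 * m ^ 2 + 4 * m)))
  simp only [mul_zero, add_zero] at hsum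
  refine hsum.congr fun N => ?_
  unfold fifthSteinPoly
  ring

theorem sum_range_sub_pow_five_mul_poissonWeight (m : ℝ) (N : ℕ) :
    ∑ j ∈ range N, ((j : ℝ) - m) ^ 5 * poissonWeight m j =
      (10 * m ^ 2 + m) * ∑ j ∈ range N, poissonWeight m j -
        N * fifthSteinPoly m N * poissonWeight m N := by
  induction N with
  | zero => simp
  | succ N ih =>
    rw [sum_range_succ, sum_range_succ, ih]
    push_cast
    have h := succ_mul_poissonWeight_succ m N
    unfold fifthSteinPoly
    linear_combination (((N : ℝ) + 1 - m) ^ 4 +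
      2 * m * (2 * ((N : ℝ) + 1 - 1 - m) ^ 2 + 7 * ((N : ℝ) + 1) - 3 * m)) * h

theorem poissonCDF_self_eq_sum_range {m : ℝ} (hm : 0 ≤ m) :
    poissonCDF m m = ∑ j ∈ range (⌊m⌋₊ + 1), poissonWeight m j := by
  unfold poissonCDF
  rw [tsum_eq_sum (s := range (⌊m⌋₊ + 1))]
  · refine sum_congr rfl fun j hj => if_pos ?_
    rw [← Nat.le_floor_iff hm]
    exact Nat.lt_succ_iff.mp (mem_range.mp hj)
  · intro j hj
    refine if_neg fun hle => hj ?_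
    exact mem_range.mpr (Nat.lt_succ_iff.mpr (Nat.le_floor hle))

theorem sum_range_abs_sub_pow_five_mul_poissonWeight {m : ℝ} (hm : 0 ≤ m) {N : ℕ}
    (hN : ⌊m⌋₊ + 1 ≤ N) :
    ∑ j ∈ range N, |(j : ℝ) - m| ^ 5 * poissonWeight m j =
      ∑ j ∈ range N, ((j : ℝ) - m) ^ 5 * poissonWeight m j -
        2 * ∑ j ∈ range (⌊m⌋₊ + 1), ((j : ℝ) - m) ^ 5 * poissonWeight m j := by
  rw [← sum_range_add_sum_Ico _ hN,
    ← sum_range_add_sum_Ico (fun j : ℕ => ((j : ℝ) - m) ^ 5 * _) hN]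
  have hlow : ∑ j ∈ range (⌊m⌋₊ + 1), |(j : ℝ) - m| ^ 5 * poissonWeight m j =
      -∑ j ∈ range (⌊m⌋₊ + 1), ((j : ℝ) - m) ^ 5 * poissonWeight m j := by
    rw [← sum_neg_distrib]
    refine sum_congr rfl fun j hj => ?_
    have hle : (j : ℝ) ≤ m :=
      (Nat.le_floor_iff hm).mp (Nat.lt_succ_iff.mp (mem_range.mp hj))
    rw [abs_of_nonpos (sub_nonpos.mpr hle)]
    ring
  have hhigh : ∑ j ∈ Ico (⌊m⌋₊ + 1) N, |(j : ℝ) - m| ^ 5 * poissonWeight m j =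
      ∑ j ∈ Ico (⌊m⌋₊ + 1) N, ((j : ℝ) - m) ^ 5 * poissonWeight m j := by
    refine sum_congr rfl fun j hj => ?_
    have hlt : m < j := (Nat.floor_lt hm).mp (Nat.succ_le_iff.mp (mem_Ico.mp hj).1)
    rw [abs_of_pos (sub_pos.mpr hlt)]
  rw [hlow, hhigh]
  ring

theorem hasSum_abs_sub_pow_five_mul_poissonWeight {m : ℝ} (hm : 0 ≤ m) :
    HasSum (fun j : ℕ => |(j : ℝ) - m| ^ 5 * poissonWeight m j)
      ((10 * m ^ 2 + m) -
        2 * ∑ j ∈ range (⌊m⌋₊ + 1), ((j : ℝ) - m) ^ 5 * poissonWeight m j) := by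
  rw [hasSum_iff_tendsto_nat_of_nonneg
    (fun j => mul_nonneg (by positivity) (poissonWeight_nonneg hm j))]
  have h := (((hasSum_poissonWeight m).tendsto_sum_nat.const_mul (10 * m ^ 2 + m)).sub
    (tendsto_mul_fifthSteinPoly_mul_poissonWeight m)).sub_const
    (2 * ∑ j ∈ range (⌊m⌋₊ + 1), ((j : ℝ) - m) ^ 5 * poissonWeight m j)
  rw [mul_one, sub_zero] at h
  refine h.congr' ?_
  filter_upwards [eventually_ge_atTop (⌊m⌋₊ + 1)] with N hN
  rw [sum_range_abs_sub_pow_five_mul_poissonWeight hm hN,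
    sum_range_sub_pow_five_mul_poissonWeight m N]

/-- For a Poisson random variable `X` with mean `m > 0`:
`E|X−m|^5 = (10·m^2 + m)·(1 − 2·F(m))
  + 2·((⌊m⌋+1−m)^4 + 2·m·(2·(m−⌊m⌋)^2 + 7·⌊m⌋ + 7 − 3·m))·e^{-m}·m^{⌊m⌋+1}/⌊m⌋!`. -/
theorem poisson_fifth_absolute_central_moment
    (m : ℝ) (hm : 0 < m) :
    (∑' j : ℕ, |(j : ℝ) - m| ^ 5 * poissonWeight m j) =
      (10 * m ^ 2 + m) * (1 - 2 * poissonCDF m m) +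
      2 * (((⌊m⌋₊ : ℝ) + 1 - m) ^ 4 +
          2 * m * (2 * (m - (⌊m⌋₊ : ℝ)) ^ 2 + 7 * (⌊m⌋₊ : ℝ) + 7 - 3 * m)) *
        Real.exp (-m) * m ^ (⌊m⌋₊ + 1) / (Nat.factorial ⌊m⌋₊ : ℝ) := by
  rw [(hasSum_abs_sub_pow_five_mul_poissonWeight hm.le).tsum_eq,
    sum_range_sub_pow_five_mul_poissonWeight, poissonCDF_self_eq_sum_range hm.le]
  unfold fifthSteinPoly
  rw [poissonWeight, Nat.factorial_succ]
  push_cast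
  field_simp
  ring
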